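/- The set of maximal minors of an m×n matrix X of distinct indeterminates is a universal Gröbner basis of the ideal I_m(X) it generates: for every term order on K[x_{ij}], the initial terms of the maximal minors generate the initial ideal of I_m(X). -/

import Mathlib

open MvPolynomial

/-- The maximal minor of the `m×n` generic matrix `X = (x_{ij})` on the columns
`c 0 < c 1 < … < c (m-1)`. -/
noncomputable def genericMinor (K : Type*) [Field K] (m n : ℕ) (c : Fin m → Fin n) :
    MvPolynomial (Fin m × Fin n) K :=
  Matrix.det (Matrix.of fun i k : Fin m => (X (i, c k) : MvPolynomial (Fin m × Fin n) K))

/-- The ideal `I_m(X)` generated by the maximal minors of the generic `m×n` matrix. -/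
noncomputable def maxMinorsIdeal (K : Type*) [Field K] (m n : ℕ) :
    Ideal (MvPolynomial (Fin m × Fin n) K) :=
  Ideal.span {f | ∃ c : Fin m → Fin n, StrictMono c ∧ f = genericMinor K m n c}

/-- The exponent of the leading monomial of `f` with respect to a monomial
(term) order on `σ →₀ ℕ`. -/
noncomputable def leadExp {σ : Type*} (mo : MonomialOrder σ) {K : Type*} [Field K]
    (f : MvPolynomial σ K) : σ →₀ ℕ :=
  mo.toSyn.symm (f.support.sup mo.toSyn)

/-- The initial ideal of `I` with respect to a monomial order: the ideal generated by
the leading terms of the nonzero elements of `I`. -/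
noncomputable def initialIdeal {σ : Type*} (mo : MonomialOrder σ) {K : Type*} [Field K]
    (I : Ideal (MvPolynomial σ K)) : Ideal (MvPolynomial σ K) :=
  Ideal.span {g | ∃ f ∈ I, f ≠ 0 ∧ g = monomial (leadExp mo f) (1 : K)}

section Spanning

variable {σ M K : Type*} [AddCommMonoid M] [Field K]

/-- If every exponent of weight `b` outside `T` is the leading exponent of a weighted homogeneous
element of `I`, then monomials with exponents in `T` span the weight `b` part modulo `I`. -/
lemma mk_mem_span_of_forall_exists_degree_eq (mo : MonomialOrder σ) (w : σ → M) (b : M)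
    (I : Ideal (MvPolynomial σ K)) (T : Set (σ →₀ ℕ))
    (hT : ∀ e, Finsupp.weight w e = b → e ∉ T →
      ∃ g ∈ I, g ≠ 0 ∧ IsWeightedHomogeneous w g b ∧ mo.degree g = e)
    {p : MvPolynomial σ K} (hp : IsWeightedHomogeneous w p b) :
    Ideal.Quotient.mkₐ K I p ∈
      Submodule.span K ((fun e => Ideal.Quotient.mkₐ K I (monomial e 1)) '' T) := by
  set π := Ideal.Quotient.mkₐ K I
  set W := Submodule.span K ((fun e => π (monomial e 1)) '' T)
  have reduce : ∀ (q : MvPolynomial σ K),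
      (∀ e ∈ q.support, π (monomial e 1) ∈ W) → π q ∈ W := by
    intro q hq
    rw [q.as_sum, map_sum]
    refine Submodule.sum_mem _ fun e he => ?_
    have : monomial e (coeff e q) = (coeff e q) • (monomial e 1 : MvPolynomial σ K) := by
      rw [smul_monomial, smul_eq_mul, mul_one]
    rw [this, map_smul]
    exact Submodule.smul_mem _ _ (hq e he)
  have key : ∀ (s : mo.syn) (e : σ →₀ ℕ), mo.toSyn e = s → Finsupp.weight w e = b →
      π (monomial e 1) ∈ W := by
    intro s
    induction s using WellFoundedLT.induction with
    | ind s ih =>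
      intro e hes heb
      by_cases heT : e ∈ T
      · exact Submodule.subset_span ⟨e, heT, rfl⟩
      obtain ⟨g, hgI, hg0, hgb, hge⟩ := hT e heb heT
      have hc : coeff e g ≠ 0 := by
        rw [← hge]; exact (mo.coeff_degree_ne_zero_iff).2 hg0
      have hπ : π (monomial e 1) = π (monomial e 1 - (coeff e g)⁻¹ • g) := by
        rw [map_sub, map_smul]
        have : π g = 0 := Ideal.Quotient.eq_zero_iff_mem.2 hgI
        rw [this, smul_zero, sub_zero]
      rw [hπ]
      refine reduce _ fun d hd => ?_
      classical
      have hde : d ≠ e := by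
        rintro rfl
        rw [mem_support_iff, coeff_sub, coeff_smul, coeff_monomial, if_pos rfl, smul_eq_mul,
          inv_mul_cancel₀ hc, sub_self] at hd
        exact hd rfl
      have hdg : coeff d g ≠ 0 := by
        intro h
        rw [mem_support_iff, coeff_sub, coeff_smul, coeff_monomial, if_neg hde.symm, h] at hd
        simp at hd
      refine ih (mo.toSyn d) ?_ d rfl (hgb hdg)
      rw [← hes]
      refine lt_of_le_of_ne ?_ fun h => hde (mo.toSyn.injective h)
      rw [← hge]
      exact mo.le_degree (mem_support_iff.2 hdg)
  exact reduce p fun e he => key _ e rfl (hp (mem_support_iff.1 he))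

lemma isWeightedHomogeneous_algHom {τ : Type*} {w : σ → M} {v : τ → M}
    (φ : MvPolynomial σ K →ₐ[K] MvPolynomial τ K)
    (hφ : ∀ i, IsWeightedHomogeneous v (φ (X i)) (w i)) {p : MvPolynomial σ K} {b : M}
    (hp : IsWeightedHomogeneous w p b) : IsWeightedHomogeneous v (φ p) b := by
  rw [p.as_sum, map_sum]
  refine IsWeightedHomogeneous.sum _ _ _ fun e he => ?_
  rw [monomial_eq, map_mul, Finsupp.prod, map_prod, algHom_C]
  refine IsWeightedHomogeneous.C_mul ?_ _
  rw [← hp (mem_support_iff.1 he), Finsupp.weight_apply, Finsupp.sum]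
  refine IsWeightedHomogeneous.prod _ _ _ fun i _ => ?_
  rw [map_pow]
  exact (hφ i).pow _

/-- Exponents in `U` are at most as many as those in `T`, if the monomials with exponents in `U`
are, after applying `φ`, linearly independent modulo `I`, while those in `T` span. -/
lemma card_le_card_of_forall_exists_degree_eq (mo : MonomialOrder σ) (w : σ → M) (b : M)
    (I : Ideal (MvPolynomial σ K)) (T U : Finset (σ →₀ ℕ))
    (hT : ∀ e, Finsupp.weight w e = b → e ∉ T →
      ∃ g ∈ I, g ≠ 0 ∧ IsWeightedHomogeneous w g b ∧ mo.degree g = e)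
    (φ : MvPolynomial σ K →ₐ[K] MvPolynomial σ K)
    (hφ : ∀ i, IsWeightedHomogeneous w (φ (X i)) (w i))
    (hUb : ∀ e ∈ U, Finsupp.weight w e = b)
    (hU : ∀ p : MvPolynomial σ K, p.support ⊆ U → φ p ∈ I → p = 0) :
    U.card ≤ T.card := by
  classical
  set π := Ideal.Quotient.mkₐ K I
  let v : U → MvPolynomial σ K ⧸ I := fun e => π (φ (monomial e.1 1))
  have hv : LinearIndependent K v := by
    rw [Fintype.linearIndependent_iff]
    intro g hg e
    set p : MvPolynomial σ K := ∑ e : U, monomial e.1 (g e) with hp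
    have hcoeff : ∀ d : σ →₀ ℕ, coeff d p = ∑ e : U, if e.1 = d then g e else 0 := by
      intro d
      rw [hp, coeff_sum]
      simp only [coeff_monomial]
    have hp0 : p = 0 := by
      refine hU p ?_ ?_
      · intro d hd
        by_contra hdU
        rw [mem_support_iff, hcoeff] at hd
        refine hd (Finset.sum_eq_zero fun e _ => if_neg ?_)
        rintro rfl
        exact hdU e.2
      · rw [← Ideal.Quotient.eq_zero_iff_mem]
        change π (φ p) = 0
        rw [← hg, hp, map_sum, map_sum]
        refine Finset.sum_congr rfl fun e _ => ?_
        have : monomial e.1 (g e) = (g e) • (monomial e.1 1 : MvPolynomial σ K) := by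
          rw [smul_monomial, smul_eq_mul, mul_one]
        rw [this, map_smul, map_smul]
    have := hcoeff e.1
    rw [hp0, coeff_zero, Finset.sum_eq_single e] at this
    · simpa using this.symm
    · intro e' _ he'
      exact if_neg fun h => he' (Subtype.ext h)
    · simp
  have hspan : Set.range v ≤
      ((Submodule.span K ((T.image fun e => π (monomial e 1) : Finset _) : Set _) :
        Submodule K (MvPolynomial σ K ⧸ I)) : Set (MvPolynomial σ K ⧸ I)) := by
    rintro _ ⟨e, rfl⟩
    rw [Finset.coe_image]
    refine mk_mem_span_of_forall_exists_degree_eq mo w b I T hT ?_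
    exact isWeightedHomogeneous_algHom φ hφ
      (isWeightedHomogeneous_monomial w _ _ (hUb e.1 e.2))
  have h := linearIndependent_le_span' v hv _ hspan
  rw [Cardinal.mk_coe_finset] at h
  have h' : U.card ≤ (T.image fun e => π (monomial e 1)).card := by
    simpa using h
  exact h'.trans Finset.card_image_le

end Spanning

section Minors

variable {K : Type*} [Field K] {m n : ℕ}

/-- The weight recording the degree of a monomial in each column of the generic matrix. -/
def colWeight (m n : ℕ) (p : Fin m × Fin n) : Fin n → ℕ := Pi.single p.2 1

lemma weight_colWeight_apply (e : Fin m × Fin n →₀ ℕ) (j : Fin n) :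
    Finsupp.weight (colWeight m n) e j = ∑ i, e (i, j) := by
  rw [Finsupp.weight_apply, Finsupp.sum_fintype _ _ (by simp), Finset.sum_apply,
    Fintype.sum_prod_type]
  refine Finset.sum_congr rfl fun i _ => ?_
  rw [Finset.sum_eq_single j]
  · simp [colWeight]
  · intro j' _ hj
    simp [colWeight, hj]
  · simp

lemma genericMinor_ne_zero {c : Fin m → Fin n} (hc : StrictMono c) : genericMinor K m n c ≠ 0 := by
  intro h
  have := congrArg (aeval fun p : Fin m × Fin n => if p.2 = c p.1 then (1 : K) else 0) h
  rw [map_zero, genericMinor, AlgHom.map_det] at this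
  have h1 : (aeval fun p : Fin m × Fin n => if p.2 = c p.1 then (1 : K) else 0).mapMatrix
      (Matrix.of fun i k : Fin m => (X (i, c k) : MvPolynomial (Fin m × Fin n) K)) = 1 := by
    ext i k
    simp [Matrix.one_apply, hc.injective.eq_iff, eq_comm]
  rw [h1, Matrix.det_one] at this
  exact one_ne_zero this

lemma prod_X_eq_monomial {σ ι : Type*} (s : Finset ι) (f : ι → σ) :
    ∏ k ∈ s, (X (f k) : MvPolynomial σ K) = monomial (∑ k ∈ s, Finsupp.single (f k) 1) 1 := by
  simp only [X]
  rw [← monomial_sum_one]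

lemma exists_perm_of_coeff_genericMinor_ne_zero {c : Fin m → Fin n} {d : Fin m × Fin n →₀ ℕ}
    (hd : coeff d (genericMinor K m n c) ≠ 0) :
    ∃ τ : Equiv.Perm (Fin m), d = ∑ k, Finsupp.single (τ k, c k) 1 := by
  classical
  rw [genericMinor, Matrix.det_apply, coeff_sum] at hd
  obtain ⟨τ, -, hτ⟩ := Finset.exists_ne_zero_of_sum_ne_zero hd
  refine ⟨τ, ?_⟩
  simp only [Matrix.of_apply, prod_X_eq_monomial, Units.smul_def] at hτ
  by_contra hne
  refine hτ ?_
  rw [coeff_smul, coeff_monomial, if_neg fun h => hne h.symm, smul_zero]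

lemma weight_sum_single (f : Fin m → Fin m) (c : Fin m → Fin n) :
    Finsupp.weight (colWeight m n) (∑ k, Finsupp.single (f k, c k) 1) =
      ∑ k, Pi.single (c k) 1 := by
  rw [map_sum]
  exact Finset.sum_congr rfl fun k _ => by rw [Finsupp.weight_single, one_smul, colWeight]

lemma isWeightedHomogeneous_genericMinor (c : Fin m → Fin n) :
    IsWeightedHomogeneous (colWeight m n) (genericMinor K m n c) (∑ k, Pi.single (c k) 1) := by
  intro d hd
  obtain ⟨τ, rfl⟩ := exists_perm_of_coeff_genericMinor_ne_zero hd
  exact weight_sum_single τ c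

lemma weightedHomogeneousComponent_mem_maxMinorsIdeal {f : MvPolynomial (Fin m × Fin n) K}
    (hf : f ∈ maxMinorsIdeal K m n) (b : Fin n → ℕ) :
    weightedHomogeneousComponent (colWeight m n) b f ∈ maxMinorsIdeal K m n := by
  let := weightedGradedAlgebra K (colWeight m n)
  refine weightedHomogeneousComponent_mem_of_mem _ _ (Ideal.homogeneous_span _ _ ?_) hf b
  rintro _ ⟨c, -, rfl⟩
  exact ⟨_, isWeightedHomogeneous_genericMinor c⟩

/-- A matrix over a domain with a nonzero left kernel vector is a zero of `I_m(X)`. -/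
lemma aeval_eq_zero_of_mem_maxMinorsIdeal {R : Type*} [CommRing R] [IsDomain R] [Algebra K R]
    (v : Fin m × Fin n → R) (t : Fin m → R) (ht : t ≠ 0) (hv : ∀ j, ∑ i, t i * v (i, j) = 0)
    {f : MvPolynomial (Fin m × Fin n) K} (hf : f ∈ maxMinorsIdeal K m n) : aeval v f = 0 := by
  suffices h : maxMinorsIdeal K m n ≤ RingHom.ker (aeval v : MvPolynomial _ K →ₐ[K] R) from h hf
  rw [maxMinorsIdeal, Ideal.span_le]
  rintro _ ⟨c, -, rfl⟩
  rw [SetLike.mem_coe, RingHom.mem_ker, genericMinor, AlgHom.map_det,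
    ← Matrix.exists_vecMul_eq_zero_iff]
  refine ⟨t, ht, ?_⟩
  ext k
  simpa [Matrix.vecMul, dotProduct] using hv (c k)

end Minors

section Shear

variable {K : Type*} [Field K] {m n : ℕ}

/-- Add to each entry of the generic matrix a multiple of the entry of row `0` in its column. -/
noncomputable def shear (a : Fin (m + 1) × Fin n → K) :
    MvPolynomial (Fin (m + 1) × Fin n) K →ₐ[K] MvPolynomial (Fin (m + 1) × Fin n) K :=
  aeval fun p => if p.1 = 0 then X p else X p + C (a p) * X (0, p.2)

lemma shear_X (a : Fin (m + 1) × Fin n → K) (p : Fin (m + 1) × Fin n) :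
    shear a (X p) = if p.1 = 0 then X p else X p + C (a p) * X (0, p.2) := by
  rw [shear, aeval_X]

lemma shear_neg_shear (a : Fin (m + 1) × Fin n → K) (p : MvPolynomial (Fin (m + 1) × Fin n) K) :
    shear (-a) (shear a p) = p := by
  suffices h : (shear (-a)).comp (shear a) = AlgHom.id K _ from DFunLike.congr_fun h p
  ext1 q
  rw [AlgHom.comp_apply, shear_X, AlgHom.id_apply]
  split_ifs with h
  · rw [shear_X, if_pos h]
  · rw [map_add, map_mul, algHom_C, shear_X, shear_X, if_neg h, if_pos rfl]
    simp [algebraMap_eq]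

lemma isWeightedHomogeneous_shear_X (a : Fin (m + 1) × Fin n → K) (p : Fin (m + 1) × Fin n) :
    IsWeightedHomogeneous (colWeight (m + 1) n) (shear a (X p)) (colWeight (m + 1) n p) := by
  rw [shear_X]
  split_ifs
  · exact isWeightedHomogeneous_X _ _ _
  · exact (isWeightedHomogeneous_X _ _ _).add
      ((isWeightedHomogeneous_X K (colWeight (m + 1) n) (0, p.2)).C_mul _)

/-- The columns in which a monomial involves the entry of row `0`. -/
def firstRowSupport (e : Fin (m + 1) × Fin n →₀ ℕ) : Finset (Fin n) :=
  Finset.univ.filter fun j => e (0, j) ≠ 0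

lemma mem_firstRowSupport {e : Fin (m + 1) × Fin n →₀ ℕ} {j : Fin n} :
    j ∈ firstRowSupport e ↔ e (0, j) ≠ 0 := by
  simp [firstRowSupport]

lemma exists_monomialOrder_of_linearOrder {σ : Type} [LinearOrder σ] [Finite σ] :
    ∃ mo : MonomialOrder.{0, 0} σ, ∀ a b, a < b →
      mo.toSyn (Finsupp.single b 1) < mo.toSyn (Finsupp.single a 1) :=
  ⟨MonomialOrder.lex, fun _ _ h => MonomialOrder.lex_lt_iff.2 (Finsupp.Lex.single_lt_iff.2 h)⟩

lemma exists_monomialOrder_single_lt (m n : ℕ) :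
    ∃ mo : MonomialOrder.{0, 0} (Fin (m + 1) × Fin n), ∀ i j, i ≠ 0 →
      mo.toSyn (Finsupp.single (i, j) 1) < mo.toSyn (Finsupp.single (0, j) 1) := by
  obtain ⟨mo, hmo⟩ := @exists_monomialOrder_of_linearOrder (Fin (m + 1) × Fin n)
    (LinearOrder.lift' (toLex : Fin (m + 1) × Fin n → Fin (m + 1) ×ₗ Fin n) toLex.injective) _
  refine ⟨mo, fun i j hi => hmo _ _ ?_⟩
  change toLex ((0 : Fin (m + 1)), j) < toLex (i, j)
  rw [Prod.Lex.toLex_lt_toLex]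
  exact Or.inl (Fin.pos_of_ne_zero hi)

lemma shear_one_X_ne_zero_and_degree (mo : MonomialOrder (Fin (m + 1) × Fin n))
    (hmo : ∀ i j, i ≠ 0 →
      mo.toSyn (Finsupp.single (i, j) 1) < mo.toSyn (Finsupp.single (0, j) 1))
    (p : Fin (m + 1) × Fin n) :
    shear (1 : Fin (m + 1) × Fin n → K) (X p) ≠ 0 ∧
      mo.degree (shear (1 : Fin (m + 1) × Fin n → K) (X p)) = Finsupp.single (0, p.2) 1 := by
  obtain ⟨i, j⟩ := p
  have hdeg : mo.degree (shear (1 : Fin (m + 1) × Fin n → K) (X (i, j))) =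
      Finsupp.single (0, j) 1 := by
    rw [shear_X]
    split_ifs with h
    · have h' : i = 0 := h
      rw [MonomialOrder.degree_X, h']
    · rw [Pi.one_apply, C_1, one_mul, MonomialOrder.degree_add_eq_right_of_lt,
        MonomialOrder.degree_X]
      rw [MonomialOrder.degree_X, MonomialOrder.degree_X]
      exact hmo i j h
  refine ⟨fun h => ?_, hdeg⟩
  rw [h, MonomialOrder.degree_zero] at hdeg
  simpa using hdeg.symm

lemma exists_mem_comap_shear_degree_eq (mo : MonomialOrder (Fin (m + 1) × Fin n))
    (hmo : ∀ i j, i ≠ 0 →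
      mo.toSyn (Finsupp.single (i, j) 1) < mo.toSyn (Finsupp.single (0, j) 1))
    (D : Set (Fin (m + 1) × Fin n →₀ ℕ))
    (hD : ∀ c : Fin (m + 1) → Fin n, StrictMono c →
      ∃ f : Fin (m + 1) → Fin (m + 1), ∑ k, Finsupp.single (f k, c k) 1 ∈ D)
    (b : Fin n → ℕ) (e : Fin (m + 1) × Fin n →₀ ℕ)
    (heb : Finsupp.weight (colWeight (m + 1) n) e = b) (he : m < (firstRowSupport e).card) :
    ∃ g ∈ (Ideal.span ((fun d => monomial d (1 : K)) '' D)).comap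
        (shear (-1 : Fin (m + 1) × Fin n → K)),
      g ≠ 0 ∧ IsWeightedHomogeneous (colWeight (m + 1) n) g b ∧ mo.degree g = e := by
  obtain ⟨A, hA, hAcard⟩ := Finset.exists_subset_card_eq (Nat.succ_le_of_lt he)
  set c := A.orderEmbOfFin hAcard with hc
  obtain ⟨f, hf⟩ := hD c c.strictMono
  set u : Fin (m + 1) × Fin n →₀ ℕ := ∑ k, Finsupp.single (0, c k) 1 with hu
  have hue : u ≤ e := by
    rintro ⟨i, j⟩
    rw [hu, Finsupp.finsetSum_apply]
    by_cases h : i = 0 ∧ ∃ k, c k = j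
    · obtain ⟨rfl, k, rfl⟩ := h
      rw [Finset.sum_eq_single k]
      · have := mem_firstRowSupport.1 (hA (A.orderEmbOfFin_mem hAcard k))
        simpa using Nat.one_le_iff_ne_zero.2 this
      · intro k' _ hk
        refine Finsupp.single_eq_of_ne ?_
        simpa [Prod.ext_iff] using hk.symm
      · simp
    · rw [Finset.sum_eq_zero]
      · exact Nat.zero_le _
      intro k _
      refine Finsupp.single_eq_of_ne ?_
      rintro ⟨⟩
      exact h ⟨rfl, k, rfl⟩
  have hprod : ∏ k, shear (1 : Fin (m + 1) × Fin n → K) (X (f k, c k)) ≠ 0 :=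
    Finset.prod_ne_zero_iff.2 fun k _ => (shear_one_X_ne_zero_and_degree mo hmo _).1
  have hmon : (monomial (e - u) 1 : MvPolynomial (Fin (m + 1) × Fin n) K) ≠ 0 := by simp
  refine ⟨monomial (e - u) 1 * ∏ k, shear (1 : Fin (m + 1) × Fin n → K) (X (f k, c k)),
    ?_, mul_ne_zero hmon hprod, ?_, ?_⟩
  · rw [Ideal.mem_comap, map_mul, map_prod]
    simp only [shear_neg_shear]
    rw [prod_X_eq_monomial]
    exact Ideal.mul_mem_left _ _ (Ideal.subset_span ⟨_, hf, rfl⟩)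
  · have h1 := isWeightedHomogeneous_monomial (R := K) (colWeight (m + 1) n) (e - u) 1 rfl
    have h2 := IsWeightedHomogeneous.prod Finset.univ _ _ fun k (_ : k ∈ Finset.univ) =>
      isWeightedHomogeneous_shear_X (1 : Fin (m + 1) × Fin n → K) (f k, c k)
    convert h1.mul h2 using 1
    have h3 : Finsupp.weight (colWeight (m + 1) n) u = ∑ k, colWeight (m + 1) n (f k, c k) :=
      weight_sum_single (fun _ => 0) c
    rw [← h3, ← map_add, tsub_add_cancel_of_le hue, heb]
  · classical
    rw [MonomialOrder.degree_mul hmon hprod, MonomialOrder.degree_monomial,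
      if_neg one_ne_zero, MonomialOrder.degree_prod fun k _ =>
        (shear_one_X_ne_zero_and_degree mo hmo _).1]
    simp only [(shear_one_X_ne_zero_and_degree (K := K) mo hmo _).2]
    exact tsub_add_cancel_of_le hue

end Shear

section Independence

variable {K : Type*} [Field K] {m n : ℕ}

lemma sum_coeff_mul_pow {p : Polynomial K} (hp : p.natDegree < m + 1) (x : K) :
    ∑ i : Fin (m + 1), p.coeff i * x ^ (i : ℕ) = p.eval x := by
  rw [Polynomial.eval_eq_sum_range' hp, Finset.sum_range]

/-- A family of linear forms with prescribed values on the columns in `A` of a Vandermonde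
matrix, and not vanishing identically on the other columns at the origin of the parameter space. -/
lemma exists_vandermonde_form {α : Fin n → K} (hα : Function.Injective α) (A : Finset (Fin n))
    (hA : A.card ≤ m) :
    ∃ τ : Fin (m + 1) → MvPolynomial (Fin n) K, τ ≠ 0 ∧
      (∀ j ∈ A, ∑ i, τ i * C (α j ^ (i : ℕ)) = X j) ∧
      (∀ j ∉ A, constantCoeff (∑ i, τ i * C (α j ^ (i : ℕ))) ≠ 0) ∧
      (A.Nonempty → ∃ i : Fin m, constantCoeff (τ i.succ) ≠ 0) := by
  classical
  set N := Lagrange.nodal A α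
  have hN : N.natDegree = A.card := Lagrange.natDegree_nodal
  have hNm : N.natDegree < m + 1 := by omega
  let τ : Fin (m + 1) → MvPolynomial (Fin n) K := fun i =>
    C (N.coeff i) + ∑ k ∈ A, X k * C ((Lagrange.basis A α k).coeff i)
  have hconst : ∀ i, constantCoeff (τ i) = N.coeff i := by
    intro i
    simp [τ]
  have hsum : ∀ j, ∑ i, τ i * C (α j ^ (i : ℕ)) =
      C (N.eval (α j)) + ∑ k ∈ A, X k * C ((Lagrange.basis A α k).eval (α j)) := by
    intro j
    simp only [τ, add_mul, Finset.sum_add_distrib, Finset.sum_mul, mul_assoc, ← C_mul]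
    rw [← map_sum, sum_coeff_mul_pow hNm, Finset.sum_comm]
    congr 1
    refine Finset.sum_congr rfl fun k hk => ?_
    rw [← Finset.mul_sum, ← map_sum, sum_coeff_mul_pow]
    rw [Lagrange.natDegree_basis hα.injOn hk]
    omega
  refine ⟨τ, fun h => ?_, fun j hj => ?_, fun j hj => ?_, fun hne => ?_⟩
  · have := congrArg constantCoeff (congrFun h ⟨A.card, by omega⟩)
    rw [hconst] at this
    simp only [Pi.zero_apply, map_zero, ← hN] at this
    exact one_ne_zero ((Lagrange.nodal_monic (s := A) (v := α)).coeff_natDegree.symm.trans this)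
  · rw [hsum, Finset.sum_eq_single j, Lagrange.eval_basis_self hα.injOn hj,
      Lagrange.eval_nodal_at_node hj]
    · simp
    · intro k _ hkj
      rw [Lagrange.eval_basis_of_ne hkj hj, C_0, mul_zero]
    · exact fun h => absurd hj h
  · rw [hsum]
    simp only [map_add, map_sum, map_mul, constantCoeff_X, zero_mul, Finset.sum_const_zero,
      add_zero, constantCoeff_C]
    rw [Lagrange.eval_nodal]
    refine Finset.prod_ne_zero_iff.2 fun k hk => sub_ne_zero.2 fun h => hj ?_
    rwa [hα h]
  · have hpos := hne.card_pos
    refine ⟨⟨A.card - 1, by omega⟩, ?_⟩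
    rw [hconst]
    have : ((⟨A.card - 1, by omega⟩ : Fin m).succ : ℕ) = N.natDegree := by
      rw [hN, Fin.val_succ]
      exact Nat.sub_add_cancel hpos
    rw [this, (Lagrange.nodal_monic (s := A) (v := α)).coeff_natDegree]
    exact one_ne_zero

/-- The part of an exponent outside row `0`. -/
noncomputable def lowerRows (e : Fin (m + 1) × Fin n →₀ ℕ) : Fin (m + 1) × Fin n →₀ ℕ :=
  Finsupp.equivFunOnFinite.symm fun p => if p.1 = 0 then 0 else e p

/-- The total degree of a column outside row `0`, for columns in `A`. -/
noncomputable def lowerDegree (A : Finset (Fin n)) (e : Fin (m + 1) × Fin n →₀ ℕ) : Fin n →₀ ℕ :=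
  Finsupp.equivFunOnFinite.symm fun j => if j ∈ A then ∑ i : Fin m, e (i.succ, j) else 0

lemma monomial_lowerRows (e : Fin (m + 1) × Fin n →₀ ℕ) :
    (monomial (lowerRows e) 1 : MvPolynomial (Fin (m + 1) × Fin n) K) =
      ∏ j, ∏ i : Fin m, X (i.succ, j) ^ e (i.succ, j) := by
  rw [monomial_eq, C_1, one_mul, Finsupp.prod_fintype _ _ (by simp),
    Fintype.prod_prod_type_right]
  refine Finset.prod_congr rfl fun j _ => ?_
  rw [Fin.prod_univ_succ]
  simp [lowerRows, Fin.succ_ne_zero]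

lemma monomial_lowerDegree {R : Type*} [CommRing R] (A : Finset (Fin n))
    (e : Fin (m + 1) × Fin n →₀ ℕ) :
    (monomial (lowerDegree A e) 1 : MvPolynomial (Fin n) R) =
      ∏ j ∈ A, X j ^ ∑ i : Fin m, e (i.succ, j) := by
  classical
  rw [monomial_eq, C_1, one_mul, Finsupp.prod_fintype _ _ (by simp),
    ← Finset.prod_mul_prod_compl A, Finset.prod_eq_one (s := Aᶜ), mul_one]
  · refine Finset.prod_congr rfl fun j hj => ?_
    simp [lowerDegree, hj]
  · intro j hj
    simp [lowerDegree, Finset.mem_compl.1 hj]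

lemma aeval_monomial_eq_monomial_lowerDegree_mul (A : Finset (Fin n))
    (ℓ s : Fin n → MvPolynomial (Fin n) (MvPolynomial (Fin (m + 1) × Fin n) K))
    (hs : ∀ j ∈ A, s j = X j) (e : Fin (m + 1) × Fin n →₀ ℕ) (r : K) :
    aeval (fun p : Fin (m + 1) × Fin n => if p.1 = 0 then ℓ p.2 else s p.2 * C (X p))
        (monomial e r) =
      monomial (lowerDegree A e) 1 * ((∏ j, ℓ j ^ e (0, j)) *
        (∏ j ∈ Aᶜ, s j ^ ∑ i : Fin m, e (i.succ, j)) * C (monomial (lowerRows e) r)) := by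
  have hr : (monomial (lowerRows e) r : MvPolynomial (Fin (m + 1) × Fin n) K) =
      C r * monomial (lowerRows e) 1 := by rw [C_mul_monomial, mul_one]
  have hA : ∏ j ∈ A, s j ^ ∑ i : Fin m, e (i.succ, j) =
      ∏ j ∈ A, X j ^ ∑ i : Fin m, e (i.succ, j) :=
    Finset.prod_congr rfl fun j hj => by rw [hs j hj]
  rw [aeval_monomial, Finsupp.prod_fintype _ _ (by simp), Fintype.prod_prod_type_right,
    monomial_lowerDegree, hr, monomial_lowerRows, ← hA]
  have : ∀ j, ∏ i : Fin (m + 1), (if (i, j).1 = 0 then ℓ (i, j).2 else s (i, j).2 * C (X (i, j)))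
      ^ e (i, j) = ℓ j ^ e (0, j) * (s j ^ ∑ i : Fin m, e (i.succ, j)) *
        C (∏ i : Fin m, X (i.succ, j) ^ e (i.succ, j)) := by
    intro j
    rw [Fin.prod_univ_succ]
    simp only [if_true, Fin.succ_ne_zero, if_false, mul_pow, Finset.prod_mul_distrib,
      Finset.prod_pow_eq_pow_sum, map_prod, map_pow, mul_assoc]
  simp only [this, Finset.prod_mul_distrib, ← Finset.prod_mul_prod_compl A
    fun j => s j ^ ∑ i : Fin m, e (i.succ, j), map_mul, map_prod]
  have halg : algebraMap K (MvPolynomial (Fin n) (MvPolynomial (Fin (m + 1) × Fin n) K)) r =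
      C (C r) := rfl
  rw [halg]
  ring

lemma lowerDegree_apply_add {b : Fin n → ℕ} {e : Fin (m + 1) × Fin n →₀ ℕ}
    (he : Finsupp.weight (colWeight (m + 1) n) e = b) {A : Finset (Fin n)} {j : Fin n}
    (hj : j ∈ A) : lowerDegree A e j + e (0, j) = b j := by
  rw [← he, weight_colWeight_apply, Fin.sum_univ_succ, add_comm]
  simp [lowerDegree, hj]

/-- Among exponents of the same weight, those with the largest degree in row `0` have minimal
`lowerDegree`. -/
lemma apply_zero_eq_of_lowerDegree_le {b : Fin n → ℕ} {e e' : Fin (m + 1) × Fin n →₀ ℕ}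
    (he : Finsupp.weight (colWeight (m + 1) n) e = b)
    (he' : Finsupp.weight (colWeight (m + 1) n) e' = b)
    (hmax : ∑ j, e (0, j) ≤ ∑ j, e' (0, j))
    (hle : lowerDegree (firstRowSupport e') e ≤ lowerDegree (firstRowSupport e') e') (j : Fin n) :
    e (0, j) = e' (0, j) := by
  have h : ∀ j ∈ Finset.univ, e' (0, j) ≤ e (0, j) := by
    intro j _
    by_cases hj : j ∈ firstRowSupport e'
    · have h1 := lowerDegree_apply_add he hj
      have h2 := lowerDegree_apply_add he' hj
      have h3 := hle j
      omega
    · have : e' (0, j) = 0 := by simpa [mem_firstRowSupport] using hj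
      omega
  exact ((Finset.sum_eq_sum_iff_of_le h).1 (le_antisymm (Finset.sum_le_sum h) hmax) j
    (Finset.mem_univ j)).symm

lemma eq_of_lowerRows_eq {e e' : Fin (m + 1) × Fin n →₀ ℕ} (h0 : ∀ j, e (0, j) = e' (0, j))
    (h : lowerRows e = lowerRows e') : e = e' := by
  ext ⟨i, j⟩
  by_cases hi : i = 0
  · rw [hi, h0]
  · simpa [lowerRows, hi] using DFunLike.congr_fun h (i, j)

/-- The monomials involving at most `m` of the entries in row `0` are, after a generic shear,
linearly independent modulo the ideal of maximal minors. -/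
lemma eq_zero_of_shear_mem_maxMinorsIdeal {α : Fin n → K} (hα : Function.Injective α)
    {b : Fin n → ℕ} {p : MvPolynomial (Fin (m + 1) × Fin n) K}
    (hb : ∀ e ∈ p.support, Finsupp.weight (colWeight (m + 1) n) e = b)
    (hp : ∀ e ∈ p.support, (firstRowSupport e).card ≤ m)
    (hI : shear (-fun q => α q.2 ^ (q.1 : ℕ)) p ∈ maxMinorsIdeal K (m + 1) n) : p = 0 := by
  classical
  by_contra hp0
  obtain ⟨e', he', hmax⟩ := Finset.exists_max_image p.support (fun e => ∑ j, e (0, j))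
    (support_nonempty.2 hp0)
  set A := firstRowSupport e' with hA
  obtain ⟨τ, hτ0, hτA, hτA', hτi⟩ := exists_vandermonde_form hα A (hp e' he')
  let ι : MvPolynomial (Fin n) K →+*
    MvPolynomial (Fin n) (MvPolynomial (Fin (m + 1) × Fin n) K) := MvPolynomial.map C
  have hι : Function.Injective ι := map_injective _ (C_injective _ _)
  let s : Fin n → MvPolynomial (Fin n) (MvPolynomial (Fin (m + 1) × Fin n) K) :=
    fun j => ι (∑ i, τ i * C (α j ^ (i : ℕ)))
  let ℓ : Fin n → MvPolynomial (Fin n) (MvPolynomial (Fin (m + 1) × Fin n) K) :=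
    fun j => ∑ i : Fin m, ι (τ i.succ) * C (X (i.succ, j))
  have hs : ∀ j ∈ A, s j = X j := fun j hj => by
    simp only [s]; rw [hτA j hj]; exact map_X _ _
  have hs' : ∀ j ∈ Aᶜ, constantCoeff (s j) ≠ 0 := by
    intro j hj
    have : constantCoeff (s j) = C (constantCoeff (∑ i, τ i * C (α j ^ (i : ℕ)))) :=
      constantCoeff_map _ _
    rw [this]
    exact (map_ne_zero_iff _ (C_injective _ _)).2 (hτA' j (Finset.mem_compl.1 hj))
  have hℓ : ∀ j ∈ A, constantCoeff (-ℓ j) ≠ 0 := by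
    intro j hj
    obtain ⟨i, hi⟩ := hτi ⟨j, hj⟩
    rw [map_neg, neg_ne_zero]
    have h1 : constantCoeff (ℓ j) = ∑ i : Fin m, C (constantCoeff (τ i.succ)) *
        (X (i.succ, j) : MvPolynomial (Fin (m + 1) × Fin n) K) := by
      simp only [ℓ, ι, map_sum, map_mul, constantCoeff_map, constantCoeff_C]
    intro h
    rw [h1] at h
    have h2 := congrArg (coeff (Finsupp.single (i.succ, j) 1)) h
    rw [coeff_sum, Finset.sum_eq_single i] at h2
    · rw [coeff_C_mul, coeff_X, if_pos rfl, mul_one, coeff_zero] at h2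
      exact hi h2
    · intro k _ hk
      rw [coeff_C_mul, coeff_X, if_neg, mul_zero]
      rw [Finsupp.single_left_inj one_ne_zero]
      simpa [Prod.ext_iff] using hk
    · simp
  have hcomp : aeval (fun q : Fin (m + 1) × Fin n =>
      if q.1 = 0 then -ℓ q.2 else s q.2 * C (X q)) p = 0 := by
    let v : Fin (m + 1) × Fin n → MvPolynomial (Fin n) (MvPolynomial (Fin (m + 1) × Fin n) K) :=
      fun q => (if q.1 = 0 then 0 else s q.2 * C (X q)) - C (C (α q.2 ^ (q.1 : ℕ))) * ℓ q.2
    have hv : aeval v (shear (-fun q => α q.2 ^ (q.1 : ℕ)) p) = 0 := by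
      refine aeval_eq_zero_of_mem_maxMinorsIdeal v (fun i => ι (τ i)) ?_ ?_ hI
      · intro h
        refine hτ0 (funext fun i => hι ?_)
        rw [congrFun h i, Pi.zero_apply, Pi.zero_apply, map_zero]
      · intro j
        simp only [v, mul_sub, Finset.sum_sub_distrib]
        have h1 : ∑ i : Fin (m + 1), ι (τ i) * (if i = 0 then 0 else s j * C (X (i, j))) =
            s j * ℓ j := by
          rw [Fin.sum_univ_succ]
          simp only [if_true, mul_zero, zero_add, Fin.succ_ne_zero, if_false, ℓ, Finset.mul_sum]
          exact Finset.sum_congr rfl fun i _ => by ring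
        have h2 : ∑ i : Fin (m + 1), ι (τ i) * (C (C (α j ^ (i : ℕ))) * ℓ j) = s j * ℓ j := by
          simp only [s, map_sum, Finset.sum_mul, map_mul]
          refine Finset.sum_congr rfl fun i _ => ?_
          have : ι (C (α j ^ (i : ℕ))) = C (C (α j ^ (i : ℕ))) := map_C _ _
          rw [this, mul_assoc]
        rw [h1, h2, sub_self]
    rw [← hv, ← AlgHom.comp_apply]
    congr 1
    refine MvPolynomial.algHom_ext fun q => ?_
    rw [aeval_X, AlgHom.comp_apply, shear_X]
    split_ifs with h
    · simp [v, h]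
    · simp only [map_add, map_mul, aeval_X, algHom_C, v, if_neg h, if_true]
      have halg : ∀ r : K, algebraMap K
          (MvPolynomial (Fin n) (MvPolynomial (Fin (m + 1) × Fin n) K)) r = C (C r) := fun _ => rfl
      rw [halg]
      simp only [Pi.neg_apply, map_neg, zero_sub, Fin.val_zero, pow_zero, C_1]
      ring
  -- Only the exponents agreeing with `e'` in row `0` contribute to the coefficient at
  -- `lowerDegree A e'`.
  set δ : MvPolynomial (Fin (m + 1) × Fin n) K := (∏ j, constantCoeff (-ℓ j) ^ e' (0, j)) *
    ∏ j ∈ Aᶜ, constantCoeff (s j) ^ ∑ i : Fin m, e' (i.succ, j) with hδ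
  have hδ0 : δ ≠ 0 := by
    refine mul_ne_zero (Finset.prod_ne_zero_iff.2 fun j _ => ?_)
      (Finset.prod_ne_zero_iff.2 fun j hj => pow_ne_zero _ (hs' j hj))
    by_cases hj : j ∈ A
    · exact pow_ne_zero _ (hℓ j hj)
    · have : e' (0, j) = 0 := by simpa [hA, mem_firstRowSupport] using hj
      rw [this, pow_zero]
      exact one_ne_zero
  have hterm : ∀ e ∈ p.support, coeff (lowerDegree A e') (aeval (fun q : Fin (m + 1) × Fin n =>
      if q.1 = 0 then -ℓ q.2 else s q.2 * C (X q)) (monomial e (coeff e p))) =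
        δ * if ∀ j, e (0, j) = e' (0, j) then monomial (lowerRows e) (coeff e p) else 0 := by
    intro e he
    rw [aeval_monomial_eq_monomial_lowerDegree_mul A (fun j => -ℓ j) s hs, coeff_monomial_mul']
    by_cases h0 : ∀ j, e (0, j) = e' (0, j)
    · have hrow : ∀ j, ∑ i : Fin m, e (i.succ, j) = ∑ i : Fin m, e' (i.succ, j) := by
        intro j
        have h1 := congrFun ((hb e he).trans (hb e' he').symm) j
        rw [weight_colWeight_apply, weight_colWeight_apply, Fin.sum_univ_succ,
          Fin.sum_univ_succ, h0] at h1
        exact Nat.add_left_cancel h1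
      have hdeg : lowerDegree A e = lowerDegree A e' := by
        ext j
        simp [lowerDegree, hrow]
      rw [hdeg, if_pos le_rfl, if_pos h0, tsub_self, one_mul, ← constantCoeff_eq]
      simp only [map_mul, map_prod, map_pow, constantCoeff_C, h0, hrow, hδ]
    · rw [if_neg h0, mul_zero, if_neg]
      exact fun hle => h0 (apply_zero_eq_of_lowerDegree_le (hb e he) (hb e' he') (hmax e he) hle)
  rw [p.as_sum, map_sum] at hcomp
  have hsum := congrArg (coeff (lowerDegree A e')) hcomp
  rw [coeff_sum, Finset.sum_congr rfl hterm, ← Finset.mul_sum, coeff_zero] at hsum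
  have hcoeff := congrArg (coeff (lowerRows e')) ((mul_eq_zero.1 hsum).resolve_left hδ0)
  rw [coeff_sum, Finset.sum_eq_single e', if_pos fun _ => rfl, coeff_monomial, if_pos rfl,
    coeff_zero] at hcoeff
  · exact mem_support_iff.1 he' hcoeff
  · intro e _ hne
    split_ifs with h
    · rw [coeff_monomial, if_neg fun hrows => hne (eq_of_lowerRows_eq h hrows)]
    · exact coeff_zero _
  · exact fun h => absurd he' h

end Independence

section InfiniteField

variable {K : Type*} [Field K] {m n : ℕ}

lemma finite_setOf_weight_colWeight_eq (b : Fin n → ℕ) :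
    {e : Fin m × Fin n →₀ ℕ | Finsupp.weight (colWeight m n) e = b}.Finite := by
  refine (Set.finite_Iic (Finsupp.equivFunOnFinite.symm fun p : Fin m × Fin n => b p.2)).subset ?_
  rintro e rfl ⟨i, j⟩
  rw [Finsupp.equivFunOnFinite_symm_apply_apply, weight_colWeight_apply]
  exact Finset.single_le_sum (f := fun i => e (i, j)) (fun _ _ => Nat.zero_le _)
    (Finset.mem_univ i)

lemma exists_sum_single_eq_degree_genericMinor (mo : MonomialOrder (Fin m × Fin n))
    {c : Fin m → Fin n} (hc : StrictMono c) :
    ∃ f : Fin m → Fin m, ∑ k, Finsupp.single (f k, c k) 1 = mo.degree (genericMinor K m n c) := by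
  obtain ⟨τ, hτ⟩ := exists_perm_of_coeff_genericMinor_ne_zero
    (mo.coeff_degree_ne_zero_iff.2 (genericMinor_ne_zero (K := K) hc))
  exact ⟨τ, hτ.symm⟩

lemma exists_mem_maxMinorsIdeal_degree_eq (mo : MonomialOrder (Fin m × Fin n))
    {c : Fin m → Fin n} (hc : StrictMono c) {e : Fin m × Fin n →₀ ℕ}
    (hle : mo.degree (genericMinor K m n c) ≤ e) :
    ∃ g ∈ maxMinorsIdeal K m n, g ≠ 0 ∧ IsWeightedHomogeneous (colWeight m n) g
      (Finsupp.weight (colWeight m n) e) ∧ mo.degree g = e := by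
  classical
  have hg := genericMinor_ne_zero (K := K) hc
  have hmon : (monomial (e - mo.degree (genericMinor K m n c)) 1 :
    MvPolynomial (Fin m × Fin n) K) ≠ 0 := by simp
  refine ⟨monomial (e - mo.degree (genericMinor K m n c)) 1 * genericMinor K m n c,
    Ideal.mul_mem_left _ _ (Ideal.subset_span ⟨c, hc, rfl⟩), mul_ne_zero hmon hg, ?_, ?_⟩
  · have h1 := isWeightedHomogeneous_monomial (R := K) (colWeight m n)
      (e - mo.degree (genericMinor K m n c)) 1 rfl
    convert h1.mul (isWeightedHomogeneous_genericMinor (K := K) c) using 1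
    rw [← isWeightedHomogeneous_genericMinor c (mo.coeff_degree_ne_zero_iff.2 hg), ← map_add,
      tsub_add_cancel_of_le hle]
  · rw [MonomialOrder.degree_mul hmon hg, MonomialOrder.degree_monomial, if_neg one_ne_zero]
    exact tsub_add_cancel_of_le hle

lemma exists_degree_genericMinor_le_of_infinite [Infinite K] (mo : MonomialOrder (Fin m × Fin n))
    {f : MvPolynomial (Fin m × Fin n) K} (hf : f ∈ maxMinorsIdeal K m n) (hf0 : f ≠ 0) :
    ∃ c, StrictMono c ∧ mo.degree (genericMinor K m n c) ≤ mo.degree f := by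
  classical
  cases m with
  | zero =>
    refine ⟨Fin.elim0, fun i => i.elim0, ?_⟩
    rw [genericMinor, Matrix.det_isEmpty, MonomialOrder.degree_one]
    exact zero_le
  | succ m =>
    by_contra! hstd
    set e₀ := mo.degree f with he₀
    set b := Finsupp.weight (colWeight (m + 1) n) e₀ with hb
    set D := {d | ∃ c, StrictMono c ∧ mo.degree (genericMinor K (m + 1) n c) = d}
    set E := (finite_setOf_weight_colWeight_eq (m := m + 1) b).toFinset with hE
    have hmemE : ∀ e, e ∈ E ↔ Finsupp.weight (colWeight (m + 1) n) e = b := fun e => by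
      rw [hE, Set.Finite.mem_toFinset, Set.mem_ofPred_eq]
    set std := E.filter fun e => ∀ d ∈ D, ¬ d ≤ e
    set ind := E.filter fun e => (firstRowSupport e).card ≤ m
    have he₀std : e₀ ∈ std := by
      refine Finset.mem_filter.2 ⟨(hmemE _).2 rfl, ?_⟩
      rintro _ ⟨c, hc, rfl⟩
      exact hstd c hc
    have h1 : std.card ≤ ind.card := by
      obtain ⟨mo', hmo'⟩ := exists_monomialOrder_single_lt m n
      refine card_le_card_of_forall_exists_degree_eq mo' (colWeight (m + 1) n) b
        ((Ideal.span ((fun d => monomial d (1 : K)) '' D)).comap (shear (-1)))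
        ind std (fun e heb he => ?_) (shear 1) (isWeightedHomogeneous_shear_X 1)
        (fun e he => (hmemE e).1 (Finset.mem_filter.1 he).1) (fun p hp hpI => ?_)
      · refine exists_mem_comap_shear_degree_eq mo' hmo' D (fun c hc => ?_) b e heb ?_
        · obtain ⟨g, hg⟩ := exists_sum_single_eq_degree_genericMinor (K := K) mo hc
          exact ⟨g, c, hc, hg.symm⟩
        · by_contra h
          exact he (Finset.mem_filter.2 ⟨(hmemE e).2 heb, not_lt.1 h⟩)
      · rw [Ideal.mem_comap, shear_neg_shear, mem_ideal_span_monomial_image] at hpI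
        by_contra hp0
        obtain ⟨e, he⟩ := support_nonempty.2 hp0
        obtain ⟨d, hd, hde⟩ := hpI e he
        exact (Finset.mem_filter.1 (hp he)).2 d hd hde
    have h2 : ind.card ≤ (std.erase e₀).card := by
      have hα : Function.Injective fun j : Fin n => Infinite.natEmbedding K j :=
        (Infinite.natEmbedding K).injective.comp Fin.val_injective
      refine card_le_card_of_forall_exists_degree_eq mo (colWeight (m + 1) n) b
        (maxMinorsIdeal K (m + 1) n) (std.erase e₀) ind (fun e heb he => ?_)
        (shear (-fun q => Infinite.natEmbedding K q.2 ^ (q.1 : ℕ)))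
        (isWeightedHomogeneous_shear_X _)
        (fun e he => (hmemE e).1 (Finset.mem_filter.1 he).1) (fun p hp hpI => ?_)
      · by_cases hee : e = e₀
        · subst hee
          have hcoeff : coeff (mo.degree f) (weightedHomogeneousComponent
              (colWeight (m + 1) n) b f) = coeff (mo.degree f) f := by
            rw [coeff_weightedHomogeneousComponent, if_pos hb.symm]
          have hf' := mo.coeff_degree_ne_zero_iff.2 hf0
          refine ⟨_, weightedHomogeneousComponent_mem_maxMinorsIdeal hf b, ?_,
            weightedHomogeneousComponent_isWeightedHomogeneous _ _, ?_⟩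
          · intro h
            rw [h, coeff_zero] at hcoeff
            exact hf' hcoeff.symm
          · refine mo.toSyn.injective (le_antisymm ?_ (mo.le_degree ?_))
            · rw [MonomialOrder.degree_le_iff]
              intro d hd
              refine mo.le_degree ?_
              rw [mem_support_iff, coeff_weightedHomogeneousComponent] at hd
              exact mem_support_iff.2 fun h => hd (by rw [h, ite_self])
            · rw [mem_support_iff, hcoeff]
              exact hf'
        · have : ∃ d ∈ D, d ≤ e := by
            by_contra! h
            exact he (Finset.mem_erase.2 ⟨hee, Finset.mem_filter.2 ⟨(hmemE e).2 heb, h⟩⟩)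
          obtain ⟨_, ⟨c, hc, rfl⟩, hle⟩ := this
          rw [← heb]
          exact exists_mem_maxMinorsIdeal_degree_eq mo hc hle
      · exact eq_zero_of_shear_mem_maxMinorsIdeal hα
          (fun e he => (hmemE e).1 (Finset.mem_filter.1 (hp he)).1)
          (fun e he => (Finset.mem_filter.1 (hp he)).2) hpI
    exact absurd (h1.trans h2) (not_le.2 (Finset.card_erase_lt_of_mem he₀std))

end InfiniteField

section BaseChange

variable {K L : Type*} [Field K] [Field L] {m n : ℕ}

lemma map_genericMinor (φ : K →+* L) (c : Fin m → Fin n) :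
    map φ (genericMinor K m n c) = genericMinor L m n c := by
  rw [genericMinor, RingHom.map_det, genericMinor]
  congr 1
  ext1 i k
  simp

lemma map_mem_maxMinorsIdeal (φ : K →+* L) {f : MvPolynomial (Fin m × Fin n) K}
    (hf : f ∈ maxMinorsIdeal K m n) : map φ f ∈ maxMinorsIdeal L m n := by
  suffices h : maxMinorsIdeal K m n ≤ (maxMinorsIdeal L m n).comap (map φ) from h hf
  rw [maxMinorsIdeal, Ideal.span_le]
  rintro _ ⟨c, hc, rfl⟩
  rw [SetLike.mem_coe, Ideal.mem_comap, map_genericMinor]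
  exact Ideal.subset_span ⟨c, hc, rfl⟩

lemma degree_map_of_injective {σ : Type*} (mo : MonomialOrder σ) {φ : K →+* L}
    (hφ : Function.Injective φ) (f : MvPolynomial σ K) : mo.degree (map φ f) = mo.degree f := by
  rw [MonomialOrder.degree, support_map_of_injective f hφ, MonomialOrder.degree]

lemma exists_degree_genericMinor_le (mo : MonomialOrder (Fin m × Fin n))
    {f : MvPolynomial (Fin m × Fin n) K} (hf : f ∈ maxMinorsIdeal K m n) (hf0 : f ≠ 0) :
    ∃ c, StrictMono c ∧ mo.degree (genericMinor K m n c) ≤ mo.degree f := by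
  let φ := algebraMap K (AlgebraicClosure K)
  have hφ : Function.Injective φ := φ.injective
  obtain ⟨c, hc, hle⟩ := exists_degree_genericMinor_le_of_infinite mo
    (map_mem_maxMinorsIdeal φ hf) ((map_ne_zero_iff _ (map_injective φ hφ)).2 hf0)
  rw [← map_genericMinor φ, degree_map_of_injective mo hφ, degree_map_of_injective mo hφ] at hle
  exact ⟨c, hc, hle⟩

end BaseChange

/-- The maximal minors of the generic `m×n` matrix form a universal Gröbner basis of
`I_m(X)`: for every term order, their leading terms generate the initial ideal. -/
theorem stmt11 {K : Type*} [Field K] {m n : ℕ} (hmn : m ≤ n)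
    (mo : MonomialOrder (Fin m × Fin n)) :
    initialIdeal mo (maxMinorsIdeal K m n) =
      Ideal.span {g | ∃ c : Fin m → Fin n, StrictMono c ∧
        g = monomial (leadExp mo (genericMinor K m n c)) (1 : K)} := by
  refine le_antisymm (Ideal.span_le.2 ?_) (Ideal.span_le.2 ?_)
  · rintro _ ⟨f, hf, hf0, rfl⟩
    obtain ⟨c, hc, hle⟩ := exists_degree_genericMinor_le mo hf hf0
    change monomial (mo.degree f) (1 : K) ∈ _
    rw [← tsub_add_cancel_of_le hle, ← one_mul (1 : K), ← monomial_mul]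
    refine Ideal.mul_mem_left _ _ (Ideal.subset_span ⟨c, hc, ?_⟩)
    rw [one_mul]
    rfl
  · rintro _ ⟨c, hc, rfl⟩
    exact Ideal.subset_span
      ⟨_, Ideal.subset_span ⟨c, hc, rfl⟩, genericMinor_ne_zero hc, rfl⟩
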